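/- arXiv:2605.29809 — 3 statements merged into one kernel-verified Lean document; each statement's English description precedes it below -/
import Mathlib

section
/- Let M, N be positive integers, t > 0 a real, and ζ ∈ (0,1), and assume MN(1−ζ) > t²·ζ. If a real number w satisfies ζ ≤ w ≤ 1 and w > (2MNζ + t² + √Γ) / (2(MN + t²)), then √(MN)·(w − ζ) > t·√( w(1−w) + ζ(1−ζ) ). (This is the algebraic core of the closed-form ownership-verification threshold: exceeding the threshold guarantees rejection of the null hypothesis in the paired t-test.) -/
/-- Exceeding the closed-form ownership-verification threshold
guarantees the paired t-test rejection inequality. -/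
theorem stmt_2 (M N : ℕ) (hM : 0 < M) (hN : 0 < N) (t ζ : ℝ) (ht : 0 < t)
    (hζ : ζ ∈ Set.Ioo (0 : ℝ) 1)
    (hMN : (M : ℝ) * N * (1 - ζ) > t ^ 2 * ζ)
    (w : ℝ) (hw1 : ζ ≤ w) (hw2 : w ≤ 1)
    (hw3 : w > (2 * (M : ℝ) * N * ζ + t ^ 2 +
        Real.sqrt ((2 * (M : ℝ) * N * ζ + t ^ 2) ^ 2 -
          4 * ((M : ℝ) * N + t ^ 2) *
            ((M : ℝ) * N * ζ ^ 2 - t ^ 2 * ζ + t ^ 2 * ζ ^ 2))) /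
      (2 * ((M : ℝ) * N + t ^ 2))) :
    Real.sqrt ((M : ℝ) * N) * (w - ζ) >
      t * Real.sqrt (w * (1 - w) + ζ * (1 - ζ)) := by
  obtain ⟨hζ0, hζ1⟩ := hζ
  have ha : 0 < (M : ℝ) * N := by positivity
  have hA : 0 < (M : ℝ) * N + t ^ 2 := by positivity
  rw [gt_iff_lt, div_lt_iff₀ (by positivity), ← lt_sub_iff_add_lt'] at hw3
  have hΓ := Real.lt_sq_of_sqrt_lt hw3
  have hf : 0 < (M : ℝ) * N * (w - ζ) ^ 2 - t ^ 2 * (w * (1 - w) + ζ * (1 - ζ)) := by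
    refine pos_of_mul_pos_right (a := 4 * ((M : ℝ) * N + t ^ 2)) ?_ (by positivity)
    linear_combination hΓ
  have hX : 0 ≤ w * (1 - w) + ζ * (1 - ζ) :=
    add_nonneg (mul_nonneg (hζ0.le.trans hw1) (sub_nonneg.2 hw2))
      (mul_nonneg hζ0.le (sub_nonneg.2 hζ1.le))
  calc t * Real.sqrt (w * (1 - w) + ζ * (1 - ζ))
      = Real.sqrt (t ^ 2 * (w * (1 - w) + ζ * (1 - ζ))) := by
        rw [Real.sqrt_mul (sq_nonneg t), Real.sqrt_sq ht.le]
    _ < Real.sqrt ((M : ℝ) * N * (w - ζ) ^ 2) :=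
        Real.sqrt_lt_sqrt (mul_nonneg (sq_nonneg t) hX) (sub_pos.1 hf)
    _ = Real.sqrt ((M : ℝ) * N) * (w - ζ) := by
        rw [Real.sqrt_mul ha.le, Real.sqrt_sq (sub_nonneg.2 hw1)]
end

section
/- Let M, N be positive integers, t > 0 a real, and ζ ∈ (0,1), and assume MN(1−ζ) > t²ζ. Then the verification quadratic f has exactly one root w₂ in the interval (ζ, 1), this root equals w₂ = (2MNζ + t² + √Γ) / (2(MN + t²)), and for all w ∈ [ζ, 1] one has f(w) > 0 if and only if w > w₂. -/
/-- An upward quadratic that is negative at `x` has its larger root to the right of `x`, and beyond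
`x` it is positive, zero or negative according to the position relative to that root. -/
theorem quadratic_eq_mul_sub_larger_root {a b c x : ℝ} (ha : 0 < a)
    (hx : a * x ^ 2 - b * x + c < 0) :
    x < (b + √(b ^ 2 - 4 * a * c)) / (2 * a) ∧
      ∀ w, x ≤ w → ∃ k, 0 < k ∧
        a * w ^ 2 - b * w + c = k * (w - (b + √(b ^ 2 - 4 * a * c)) / (2 * a)) := by
  have hsq : (2 * a * x - b) ^ 2 < b ^ 2 - 4 * a * c := by nlinarith
  have hΓ : 0 ≤ b ^ 2 - 4 * a * c := (sq_nonneg _).trans hsq.le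
  obtain ⟨hlo, hhi⟩ := abs_lt.mp (Real.lt_sqrt_of_sq_lt ((sq_abs _).trans_lt hsq))
  have hs := Real.sq_sqrt hΓ
  set s := √(b ^ 2 - 4 * a * c)
  refine ⟨by rw [lt_div_iff₀ (by positivity)]; linarith,
    fun w hw => ⟨(2 * a * w - b + s) / 2, ?_, ?_⟩⟩
  · nlinarith [mul_le_mul_of_nonneg_left hw ha.le]
  · field_simp
    linear_combination hs

/-- Under `MN(1-ζ) > t²ζ`, the verification quadratic `f` has a
unique root `w₂` in `(ζ, 1)`, given by the closed-form expression, and on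
`[ζ, 1]` we have `f w > 0 ↔ w > w₂`. -/
theorem stmt_6 (M N : ℕ) (hM : 0 < M) (hN : 0 < N) (t ζ : ℝ) (ht : 0 < t)
    (hζ : ζ ∈ Set.Ioo (0 : ℝ) 1)
    (hMN : (M : ℝ) * N * (1 - ζ) > t ^ 2 * ζ)
    (f : ℝ → ℝ)
    (hf : ∀ w, f w = ((M : ℝ) * N + t ^ 2) * w ^ 2 -
      (2 * (M : ℝ) * N * ζ + t ^ 2) * w +
      ((M : ℝ) * N * ζ ^ 2 - t ^ 2 * ζ + t ^ 2 * ζ ^ 2))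
    (Γ : ℝ)
    (hΓ : Γ = (2 * (M : ℝ) * N * ζ + t ^ 2) ^ 2 -
      4 * ((M : ℝ) * N + t ^ 2) *
        ((M : ℝ) * N * ζ ^ 2 - t ^ 2 * ζ + t ^ 2 * ζ ^ 2))
    (w₂ : ℝ)
    (hw₂ : w₂ = (2 * (M : ℝ) * N * ζ + t ^ 2 + Real.sqrt Γ) /
      (2 * ((M : ℝ) * N + t ^ 2))) :
    (∃! w, w ∈ Set.Ioo ζ 1 ∧ f w = 0) ∧
    w₂ ∈ Set.Ioo ζ 1 ∧ f w₂ = 0 ∧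
    (∀ w ∈ Set.Icc ζ 1, (0 < f w ↔ w₂ < w)) := by
  obtain ⟨hζ0, hζ1⟩ := hζ
  have ha : 0 < (M : ℝ) * N + t ^ 2 := by positivity
  have hfζ : f ζ < 0 := by
    have : f ζ = -(2 * t ^ 2 * ζ * (1 - ζ)) := by rw [hf]; ring
    rw [this, neg_lt_zero]
    have := sub_pos.mpr hζ1
    positivity
  have hf1 : 0 < f 1 := by
    have : f 1 = (1 - ζ) * ((M : ℝ) * N * (1 - ζ) - t ^ 2 * ζ) := by rw [hf]; ring
    rw [this]
    exact mul_pos (sub_pos.mpr hζ1) (sub_pos.mpr hMN)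
  obtain ⟨hlt, hfac⟩ := quadratic_eq_mul_sub_larger_root ha (hf ζ ▸ hfζ)
  rw [← hΓ, ← hw₂] at hlt
  simp only [← hΓ, ← hw₂, ← hf] at hfac
  have hpos : ∀ w, ζ ≤ w → (0 < f w ↔ w₂ < w) := fun w hw => by
    obtain ⟨k, hk, h⟩ := hfac w hw
    rw [h, mul_pos_iff_of_pos_left hk, sub_pos]
  have hzero : ∀ w, ζ ≤ w → (f w = 0 ↔ w = w₂) := fun w hw => by
    obtain ⟨k, hk, h⟩ := hfac w hw
    rw [h, mul_eq_zero_iff_left hk.ne', sub_eq_zero]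
  have hmem : w₂ ∈ Set.Ioo ζ 1 := ⟨hlt, (hpos 1 hζ1.le).mp hf1⟩
  have hroot : f w₂ = 0 := (hzero w₂ hlt.le).mpr rfl
  exact ⟨⟨w₂, ⟨hmem, hroot⟩, fun w hw => (hzero w hw.1.1.le).mp hw.2⟩, hmem, hroot,
    fun w hw => hpos w hw.1⟩
end

section
/- Let p ∈ (0,1) and r ≥ 0. For every measurable test φ : ℝ → [0,1] with ∫ φ dN(0,1) ≤ 1 − p, it holds that ∫ (1 − φ) dN(r,1) ≥ Φ(Φ⁻¹(p) − r). That is, when testing the standard Gaussian null N(0,1) against the shifted alternative N(r,1), any test with Type-I error at most 1 − p has Type-II error at least Φ(Φ⁻¹(p) − r). -/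
open MeasureTheory ProbabilityTheory

/-- `Φ`: the cumulative distribution function of the standard Gaussian. -/
noncomputable def stdGaussCDF : ℝ → ℝ := fun x => cdf (gaussianReal 0 1) x

/-- `Φ⁻¹`: the inverse of the standard Gaussian CDF (on `(0,1)`). -/
noncomputable def stdGaussCDFInv : ℝ → ℝ := Function.invFun stdGaussCDF

theorem continuous_stdGaussCDF : Continuous stdGaussCDF := by
  rw [continuous_iff_continuousAt]
  intro x
  have hm : Monotone (cdf (gaussianReal 0 1)) := monotone_cdf _
  have : NullSingletonClass (gaussianReal 0 1) := nullSingletonClass_gaussianReal one_ne_zero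
  have hx : (cdf (gaussianReal 0 1)).measure {x} = 0 := by
    rw [measure_cdf]
    exact measure_singleton x
  rw [StieltjesFunction.measure_singleton, ENNReal.ofReal_eq_zero] at hx
  refine hm.continuousAt_iff_leftLim_eq_rightLim.2 ?_
  rw [StieltjesFunction.rightLim_eq]
  exact le_antisymm (hm.leftLim_le le_rfl) (by linarith)

theorem stdGaussCDF_stdGaussCDFInv {p : ℝ} (hp : p ∈ Set.Ioo (0 : ℝ) 1) :
    stdGaussCDF (stdGaussCDFInv p) = p := by
  refine Function.invFun_eq (mem_range_of_exists_le_of_exists_ge continuous_stdGaussCDF ?_ ?_)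
  · exact (((tendsto_cdf_atBot (gaussianReal 0 1)).eventually_lt_const hp.1).mono
      fun _ hx => hx.le).exists
  · exact (((tendsto_cdf_atTop (gaussianReal 0 1)).eventually_const_lt hp.2).mono
      fun _ hx => hx.le).exists

theorem gaussianReal_real_Iic (r t : ℝ) :
    (gaussianReal r 1).real (Set.Iic t) = stdGaussCDF (t - r) := by
  have hmap : (gaussianReal 0 1).map (fun x => x + r) = gaussianReal r 1 := by
    rw [gaussianReal_map_add_const, zero_add]
  rw [← hmap, map_measureReal_apply (by fun_prop) measurableSet_Iic, stdGaussCDF, cdf_eq_real]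
  congr 1
  ext x
  simp [le_sub_iff_add_le]

theorem gaussianPDFReal_one_eq_exp_mul (r x : ℝ) :
    gaussianPDFReal r 1 x = Real.exp (r * x - r ^ 2 / 2) * gaussianPDFReal 0 1 x := by
  simp only [gaussianPDFReal, NNReal.coe_one]
  rw [mul_left_comm, ← Real.exp_add]
  congr 2
  ring

/-- The function `Set.indicator (Set.Iic t) 1` is the Neyman-Pearson optimal acceptance
function, here in integrated form for `N(0,1)` against `N(r,1)`. -/
theorem exp_mul_integral_sub_le_integral_sub {r : ℝ} (hr : 0 ≤ r) (t : ℝ) {ψ : ℝ → ℝ}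
    (hψ : Measurable ψ) (hψ01 : ∀ x, ψ x ∈ Set.Icc (0 : ℝ) 1) :
    Real.exp (r * t - r ^ 2 / 2) *
        (∫ x, ψ x ∂(gaussianReal 0 1) - (gaussianReal 0 1).real (Set.Iic t)) ≤
      ∫ x, ψ x ∂(gaussianReal r 1) - (gaussianReal r 1).real (Set.Iic t) := by
  set A : ℝ → ℝ := (Set.Iic t).indicator 1 with hA
  have hAm : Measurable A := measurable_one.indicator measurableSet_Iic
  have hψi (m : ℝ) : Integrable ψ (gaussianReal m 1) :=
    Integrable.of_bound hψ.aestronglyMeasurable 1 (.of_forall fun x => by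
      rw [Real.norm_eq_abs, abs_of_nonneg (hψ01 x).1]
      exact (hψ01 x).2)
  have hAi (m : ℝ) : Integrable A (gaussianReal m 1) :=
    (integrable_const (1 : ℝ)).indicator measurableSet_Iic
  have hdiff (m : ℝ) : ∫ x, ψ x ∂(gaussianReal m 1) - (gaussianReal m 1).real (Set.Iic t) =
      ∫ x, gaussianPDFReal m 1 x * (ψ x - A x) := by
    rw [← integral_indicator_one measurableSet_Iic, ← integral_sub (hψi m) (hAi m),
      integral_gaussianReal_eq_integral_smul one_ne_zero]
    rfl
  have hint (m : ℝ) : Integrable (fun x => gaussianPDFReal m 1 x * (ψ x - A x)) := by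
    refine (integrable_gaussianPDFReal m 1).mul_bdd (c := 1)
      (hψ.sub hAm).aestronglyMeasurable (.of_forall fun x => ?_)
    have h01 := hψ01 x
    by_cases hx : x ≤ t <;> simp [hA, hx, abs_le] <;> constructor <;> linarith [h01.1, h01.2]
  rw [hdiff, hdiff, ← integral_const_mul]
  refine integral_mono ((hint 0).const_mul _) (hint r) fun x => ?_
  have h01 := hψ01 x
  have hpos := gaussianPDFReal_nonneg 0 1 x
  simp only [gaussianPDFReal_one_eq_exp_mul r x]
  rw [mul_assoc]
  by_cases hx : x ≤ t
  · have hle : ψ x - A x ≤ 0 := by simp [hA, hx, h01.2]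
    refine mul_le_mul_of_nonpos_right ?_ (mul_nonpos_of_nonneg_of_nonpos hpos hle)
    gcongr
  · have hle : 0 ≤ ψ x - A x := by simp [hA, hx, h01.1]
    refine mul_le_mul_of_nonneg_right ?_ (mul_nonneg hpos hle)
    gcongr
    exact (not_le.1 hx).le

/-- any test of the null `N(0,1)` against the alternative
`N(r,1)` with Type-I error at most `1 - p` has Type-II error at least
`Φ(Φ⁻¹(p) - r)`. -/
theorem stmt_15 (p r : ℝ) (hp : p ∈ Set.Ioo (0 : ℝ) 1) (hr : 0 ≤ r)
    (φ : ℝ → ℝ) (hφ : Measurable φ) (hφ01 : ∀ x, φ x ∈ Set.Icc (0 : ℝ) 1)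
    (h : ∫ x, φ x ∂(gaussianReal 0 1) ≤ 1 - p) :
    ∫ x, (1 - φ x) ∂(gaussianReal r 1) ≥ stdGaussCDF (stdGaussCDFInv p - r) := by
  have hφi : Integrable φ (gaussianReal 0 1) :=
    Integrable.of_bound hφ.aestronglyMeasurable 1 (.of_forall fun x => by
      rw [Real.norm_eq_abs, abs_of_nonneg (hφ01 x).1]
      exact (hφ01 x).2)
  have hmain := exp_mul_integral_sub_le_integral_sub hr (stdGaussCDFInv p)
    (ψ := fun x => 1 - φ x) (hφ.const_sub 1)
    fun x => ⟨by linarith [(hφ01 x).2], by linarith [(hφ01 x).1]⟩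
  have hnull : ∫ x, (1 - φ x) ∂(gaussianReal 0 1) = 1 - ∫ x, φ x ∂(gaussianReal 0 1) := by
    rw [integral_sub (integrable_const _) hφi]
    simp
  rw [gaussianReal_real_Iic, gaussianReal_real_Iic, sub_zero, stdGaussCDF_stdGaussCDFInv hp,
    hnull] at hmain
  have hnonneg : 0 ≤ Real.exp (r * stdGaussCDFInv p - r ^ 2 / 2) *
      (1 - ∫ x, φ x ∂(gaussianReal 0 1) - p) :=
    mul_nonneg (Real.exp_pos _).le (by linarith)
  linarith
end
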